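/- arXiv:1901.07418 — 2 statements merged into one kernel-verified Lean document; each statement's English description precedes it below -/
import Mathlib

section
/- For any two blocks of the SPC resolvable design taken from different parallel classes, the intersection has cardinality q^{k−3}: if k ≥ 3, then for all i ≠ i' in {1, …, k} and all l, l' ∈ Z_q, |B_{i,l} ∩ B_{i',l'}| = q^{k−3}. -/
/-- The single parity-check encoding: `spcE q k u` is the codeword in `(ZMod q)^k`
whose first `k-1` coordinates are the message `u` and whose last coordinate is
the sum of the message symbols. -/
def spcE (q k : ℕ) (u : Fin (k - 1) → ZMod q) : Fin k → ZMod q :=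
  fun i => if h : (i : ℕ) < k - 1 then u ⟨i, h⟩ else ∑ j, u j

/-- The block `B_{i,l}` of the SPC resolvable design: all points (messages)
whose codeword has `i`-th coordinate equal to `l`. -/
def spcB (q k : ℕ) (i : Fin k) (l : ZMod q) : Set (Fin (k - 1) → ZMod q) :=
  {u | spcE q k u i = l}

/-- The coordinates `i` and `i'` of the codeword, as an additive homomorphism of the message. -/
def spcPairHom (q k : ℕ) (i i' : Fin k) :
    (Fin (k - 1) → ZMod q) →+ ZMod q × ZMod q where
  toFun u := (spcE q k u i, spcE q k u i')
  map_zero' := by ext <;> simp [spcE]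
  map_add' u v := by
    ext <;> simp only [spcE, Prod.mk_add_mk] <;> split_ifs <;>
      simp [Finset.sum_add_distrib]

/-- A message coordinate and any other codeword coordinate can be prescribed independently. -/
theorem exists_spcE_eq_of_lt {q k : ℕ} (hk : 3 ≤ k) {i i' : Fin k} (hii' : i ≠ i')
    (hi : (i : ℕ) < k - 1) (l l' : ZMod q) :
    ∃ u, spcE q k u i = l ∧ spcE q k u i' = l' := by
  by_cases hi' : (i' : ℕ) < k - 1
  · have hne : (⟨i', hi'⟩ : Fin (k - 1)) ≠ ⟨i, hi⟩ := by
      simpa [Fin.ext_iff] using Fin.val_ne_of_ne hii'.symm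
    refine ⟨Pi.single ⟨i, hi⟩ l + Pi.single ⟨i', hi'⟩ l', ?_, ?_⟩
    · simp [spcE, hi, Pi.single_eq_of_ne hne.symm]
    · simp [spcE, hi', Pi.single_eq_of_ne hne]
  · have : Nontrivial (Fin (k - 1)) := Fin.nontrivial_iff_two_le.2 (by omega)
    obtain ⟨j, hj⟩ := exists_ne (⟨i, hi⟩ : Fin (k - 1))
    refine ⟨Pi.single ⟨i, hi⟩ l + Pi.single j (l' - l), ?_, ?_⟩
    · simp [spcE, hi, Pi.single_eq_of_ne hj.symm]
    · simp [spcE, hi', Finset.sum_add_distrib]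

theorem spcPairHom_surjective {q k : ℕ} (hk : 3 ≤ k) {i i' : Fin k} (hii' : i ≠ i') :
    Function.Surjective (spcPairHom q k i i') := by
  rintro ⟨l, l'⟩
  by_cases hi : (i : ℕ) < k - 1
  · obtain ⟨u, h, h'⟩ := exists_spcE_eq_of_lt hk hii' hi l l'
    exact ⟨u, Prod.ext h h'⟩
  · have hi' : (i' : ℕ) < k - 1 := by
      have := Fin.val_ne_of_ne hii'
      omega
    obtain ⟨u, h', h⟩ := exists_spcE_eq_of_lt hk hii'.symm hi' l' l
    exact ⟨u, Prod.ext h h'⟩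

/-- The fibres of a surjective homomorphism of finite additive groups are equinumerous. -/
theorem AddMonoidHom.card_mul_card_fiber_of_surjective {G H : Type*} [AddGroup G] [AddGroup H]
    [Fintype G] [Fintype H] [DecidableEq H] (f : G →+ H) (hf : Function.Surjective f) (y : H) :
    Fintype.card H * (Finset.univ.filter fun g => f g = y).card = Fintype.card G := by
  have h := Finset.card_eq_sum_card_fiberwise (s := (Finset.univ : Finset G))
    (t := (Finset.univ : Finset H)) (f := f) (fun _ _ => Finset.mem_coe.2 (Finset.mem_univ _))
  rw [Finset.sum_congr rfl fun z _ =>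
    AddMonoidHom.card_fiber_eq_of_mem_range f (hf z) (hf y)] at h
  simpa using h.symm

/-- Two blocks from different parallel classes intersect in exactly `q^(k-3)` points. -/
theorem spc_cross_class_intersection (q k : ℕ) (hq : 2 ≤ q) (hk : 3 ≤ k)
    (i i' : Fin k) (hii' : i ≠ i') (l l' : ZMod q) :
    (spcB q k i l ∩ spcB q k i' l').ncard = q ^ (k - 3) := by
  have : NeZero q := ⟨by omega⟩
  have hset : spcB q k i l ∩ spcB q k i' l' =
      ((Finset.univ.filter fun u => spcPairHom q k i i' u = (l, l') : Finset _) : Set _) := by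
    ext u
    simp [spcB, spcPairHom]
  have hcard := (spcPairHom q k i i').card_mul_card_fiber_of_surjective
    (spcPairHom_surjective hk hii') (l, l')
  rw [hset, Set.ncard_coe_finset]
  have hpow : q ^ (k - 1) = q * q * q ^ (k - 3) := by
    rw [← pow_two, ← pow_add]
    congr 1
    omega
  simp only [Fintype.card_prod, ZMod.card, Fintype.card_fun, Fintype.card_fin, hpow] at hcard
  exact Nat.eq_of_mul_eq_mul_left (by positivity) hcard
end

section
/- Suppose one block B_{ℓ,j_ℓ} is chosen from each of the k parallel classes such that ∩_{ℓ=1}^{k} B_{ℓ,j_ℓ} = ∅. Then for every index k' ∈ {1, …, k}, the intersection of the remaining k−1 blocks, ∩_{ℓ≠k'} B_{ℓ,j_ℓ}, is a singleton {x}, and the point x does not belong to B_{k',j_{k'}} (this is the key property used to form the Stage 2 shuffling groups). -/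
theorem spcE_castSucc (q n : ℕ) (u : Fin n → ZMod q) (i : Fin n) :
    spcE q (n + 1) u i.castSucc = u i := by
  simp [spcE]

theorem spcE_last (q n : ℕ) (u : Fin n → ZMod q) :
    spcE q (n + 1) u (Fin.last n) = ∑ i, u i := by
  simp [spcE]

/-- Any prescription of all codeword symbols but one is realized by some message. -/
theorem exists_spcE_eq_off (q n : ℕ) (j : Fin (n + 1) → ZMod q) (k' : Fin (n + 1)) :
    ∃ x : Fin n → ZMod q, ∀ ℓ, ℓ ≠ k' → spcE q (n + 1) x ℓ = j ℓ := by
  induction k' using Fin.lastCases with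
  | last =>
    refine ⟨fun i => j i.castSucc, fun ℓ hℓ => ?_⟩
    induction ℓ using Fin.lastCases with
    | last => exact absurd rfl hℓ
    | cast i => exact spcE_castSucc q n _ i
  | cast i =>
    refine ⟨Function.update (fun a => j a.castSucc) i
      (j (Fin.last n) - ∑ a ∈ Finset.univ \ {i}, j a.castSucc), fun ℓ hℓ => ?_⟩
    induction ℓ using Fin.lastCases with
    | last =>
      rw [spcE_last, Finset.sum_update_of_mem (Finset.mem_univ i), sub_add_cancel]
    | cast a =>
      rw [spcE_castSucc, Function.update_of_ne (fun e => hℓ (congrArg Fin.castSucc e))]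

/-- Distinct codewords differ in at least two symbols. -/
theorem eq_of_spcE_eq_off (q n : ℕ) (x y : Fin n → ZMod q) (k' : Fin (n + 1))
    (hxy : ∀ ℓ, ℓ ≠ k' → spcE q (n + 1) x ℓ = spcE q (n + 1) y ℓ) : x = y := by
  have hcoord : ∀ a : Fin n, a.castSucc ≠ k' → x a = y a := fun a ha => by
    simpa only [spcE_castSucc] using hxy a.castSucc ha
  funext a
  by_cases ha : a.castSucc = k'
  · have hsum : ∑ i, x i = ∑ i, y i := by
      simpa only [spcE_last] using
        hxy (Fin.last n) (fun e => (Fin.castSucc_lt_last a).ne (ha.trans e.symm))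
    have hrest : ∑ i ∈ Finset.univ.erase a, x i = ∑ i ∈ Finset.univ.erase a, y i :=
      Finset.sum_congr rfl fun b hb => hcoord b fun e =>
        Finset.ne_of_mem_erase hb (Fin.castSucc_injective n (e.trans ha.symm))
    rw [← Finset.add_sum_erase _ x (Finset.mem_univ a),
      ← Finset.add_sum_erase _ y (Finset.mem_univ a), hrest] at hsum
    exact add_right_cancel hsum
  · exact hcoord a ha

/-- If one block is chosen from each of the `k` parallel classes and the `k` blocks have
empty common intersection, then for every `k'` the intersection of the remaining `k-1`
blocks is a singleton `{x}`, and `x` does not belong to the excluded block. -/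
theorem spc_stage2_group_property (q k : ℕ) (hq : 2 ≤ q) (hk : 2 ≤ k) (j : Fin k → ZMod q)
    (h : (⋂ ℓ : Fin k, spcB q k ℓ (j ℓ)) = ∅) (k' : Fin k) :
    ∃ x : Fin (k - 1) → ZMod q,
      (⋂ ℓ ∈ {ℓ : Fin k | ℓ ≠ k'}, spcB q k ℓ (j ℓ)) = {x} ∧ x ∉ spcB q k k' (j k') := by
  obtain ⟨n, rfl⟩ : ∃ n, k = n + 1 := ⟨k - 1, by omega⟩
  obtain ⟨x, hx⟩ := exists_spcE_eq_off q n j k'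
  refine ⟨x, Set.ext fun y => ?_, fun hxk => ?_⟩
  · simp only [Set.mem_iInter, Set.mem_ofPred_eq, Set.mem_singleton_iff, spcB]
    refine ⟨fun hy => ?_, fun e => e ▸ hx⟩
    exact eq_of_spcE_eq_off q n y x k' fun ℓ hℓ => (hy ℓ hℓ).trans (hx ℓ hℓ).symm
  · have hmem : x ∈ ⋂ ℓ, spcB q (n + 1) ℓ (j ℓ) := Set.mem_iInter.2 fun ℓ => by
      by_cases e : ℓ = k'
      · exact e ▸ hxk
      · exact hx ℓ e
    exact (h ▸ hmem : x ∈ (∅ : Set (Fin n → ZMod q)))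
end
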